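/- There is no computable function v : ℕ → ℕ → ℚ such that for every e ∈ ℕ: if the e-th partial computable function ℕ →. ℕ is total then v(t, e) → 1 as t → ∞, and if it is not total then v(t, e) → 0 as t → ∞. -/

import Mathlib

open Encodable Denumerable

/-- The increasing enumeration of an infinite decidable set of naturals is computable. -/
theorem Computable.nat_subtype_ofNat (s : Set ℕ) [DecidablePred (· ∈ s)] [Infinite s]
    (hs : Computable fun n => decide (n ∈ s)) :
    Computable fun n => (Nat.Subtype.ofNat s n : ℕ) := by
  have hadd : Computable₂ ((· + ·) : ℕ → ℕ → ℕ) := Primrec.nat_add.to_comp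
  have hstep : Partrec₂ fun (_ : ℕ) (p : ℕ × ℕ) =>
      (Nat.rfind fun k => Part.some (decide (p.2 + k + 1 ∈ s))).map fun k => p.2 + k + 1 := by
    refine Partrec.map (Partrec.rfind ?_) ?_
    · exact (hs.comp (Computable.succ.comp (hadd.comp
        (Computable.snd.comp (Computable.snd.comp Computable.fst)) Computable.snd))).partrec
    · exact Computable.succ.comp (hadd.comp
        (Computable.snd.comp (Computable.snd.comp Computable.fst)) Computable.snd)
  refine (Partrec.nat_rec Computable.id
    (Computable.const ((Nat.Subtype.ofNat s 0 : s) : ℕ)).partrec hstep).of_eq_tot fun n => ?_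
  induction n with
  | zero => exact Part.mem_some _
  | succ n ih =>
    refine Part.mem_bind ih (Part.mem_map_iff _ |>.2 ?_)
    have hex := Nat.Subtype.exists_succ (Nat.Subtype.ofNat s n)
    refine ⟨Nat.find hex, Nat.mem_rfind.2 ⟨?_, fun {m} hm => ?_⟩, rfl⟩
    · simpa using Nat.find_spec hex
    · simpa using Nat.find_min hex hm

/-- If the codes of an infinite encodable type form a decidable set, then its compressed coding
`Denumerable.ofEncodableOfInfinite` can be translated computably back to the original one. -/
theorem Denumerable.computable_encode_ofNat_ofEncodableOfInfinite (α : Type*) [E : Encodable α]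
    [Infinite α] (h : ComputablePred fun n => n ∈ Set.range (encode : α → ℕ)) :
    Computable fun n => E.encode (@ofNat α (ofEncodableOfInfinite α) n) := by
  let _ := decidableRangeEncode α
  have : Infinite (Set.range (encode : α → ℕ)) :=
    Infinite.of_injective _ (Equiv.ofInjective _ encode_injective).injective
  refine (Computable.nat_subtype_ofNat (Set.range (encode : α → ℕ)) h.decide).of_eq fun n => ?_
  exact congrArg Subtype.val
    ((equivRangeEncode α).apply_symm_apply (Nat.Subtype.ofNat (Set.range encode) n)).symm

namespace Rat

theorem encode_eq_pair (q : ℚ) :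
    instEncodable.encode q = Nat.pair (encode q.num) q.den := rfl

theorem exists_encode_int (a : ℕ) : ∃ z : ℤ, encode z = a ∧ z.natAbs = (a + 1) / 2 := by
  obtain ⟨m, rfl | rfl⟩ := Nat.even_or_odd' a
  · exact ⟨m, rfl, by rw [Int.natAbs_natCast]; lia⟩
  · exact ⟨Int.negSucc m, rfl, by rw [Int.natAbs_negSucc]; lia⟩

theorem mem_range_encode_iff (x : ℕ) :
    x ∈ Set.range instEncodable.encode ↔
      0 < x.unpair.2 ∧ ((x.unpair.1 + 1) / 2).Coprime x.unpair.2 := by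
  constructor
  · rintro ⟨q, rfl⟩
    obtain ⟨z, hz, hz'⟩ := exists_encode_int (encode q.num)
    obtain rfl := encode_injective hz
    rw [encode_eq_pair, Nat.unpair_pair]
    exact ⟨q.pos, hz' ▸ q.reduced⟩
  · rintro ⟨hpos, hcop⟩
    obtain ⟨z, hz, hz'⟩ := exists_encode_int x.unpair.1
    refine ⟨⟨z, x.unpair.2, hpos.ne', hz' ▸ hcop⟩, ?_⟩
    rw [encode_eq_pair, hz, Nat.pair_unpair]

end Rat

theorem Nat.coprime_iff_forall_lt (a b : ℕ) :
    a.Coprime b ↔ ∀ d < a + b + 1, d = 1 ∨ ¬(a % d = 0 ∧ b % d = 0) := by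
  constructor
  · exact fun h d _ => or_iff_not_imp_right.2 fun hd => Nat.eq_one_of_dvd_coprimes h
      (Nat.dvd_of_mod_eq_zero (not_not.1 hd).1) (Nat.dvd_of_mod_eq_zero (not_not.1 hd).2)
  · intro h
    refine (h (a.gcd b) ?_).resolve_right fun h' => h' ⟨?_, ?_⟩
    · obtain h0 | h0 := Nat.eq_zero_or_pos (a + b)
      · obtain ⟨rfl, rfl⟩ := Nat.add_eq_zero_iff.1 h0
        simp
      · exact Nat.lt_succ_of_le (Nat.le_of_dvd h0
          (dvd_add (Nat.gcd_dvd_left a b) (Nat.gcd_dvd_right a b)))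
    · exact Nat.mod_eq_zero_of_dvd (Nat.gcd_dvd_left a b)
    · exact Nat.mod_eq_zero_of_dvd (Nat.gcd_dvd_right a b)

theorem Primrec.nat_coprime : PrimrecRel Nat.Coprime := by
  have hR : PrimrecRel fun (d : ℕ) (p : ℕ × ℕ) => d = 1 ∨ ¬(p.1 % d = 0 ∧ p.2 % d = 0) := by
    have ha : Primrec fun q : ℕ × ℕ × ℕ => q.2.1 := Primrec.fst.comp Primrec.snd
    have hb : Primrec fun q : ℕ × ℕ × ℕ => q.2.2 := Primrec.snd.comp Primrec.snd
    refine PrimrecPred.or (Primrec.eq.comp Primrec.fst (Primrec.const 1))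
      (PrimrecPred.not (PrimrecPred.and ?_ ?_))
    · exact Primrec.eq.comp (Primrec.nat_mod.comp ha Primrec.fst) (Primrec.const 0)
    · exact Primrec.eq.comp (Primrec.nat_mod.comp hb Primrec.fst) (Primrec.const 0)
  refine PrimrecPred.of_eq (hR.forall_mem_list.comp
    (Primrec.list_range.comp (Primrec.succ.comp Primrec.nat_add)) Primrec.id) fun p => ?_
  simp only [List.mem_range]
  exact (Nat.coprime_iff_forall_lt p.1 p.2).symm

theorem Rat.primrecPred_mem_range_encode :
    PrimrecPred fun x => x ∈ Set.range instEncodable.encode := by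
  refine PrimrecPred.of_eq (PrimrecPred.and
    (Primrec.nat_lt.comp (Primrec.const 0) (Primrec.snd.comp Primrec.unpair))
    (Primrec.nat_coprime.comp ?_ (Primrec.snd.comp Primrec.unpair))) fun x => (mem_range_encode_iff x).symm
  exact Primrec.nat_div.comp (Primrec.succ.comp (Primrec.fst.comp Primrec.unpair))
    (Primrec.const 2)

theorem Rat.lt_half_iff (q : ℚ) :
    q < 1 / 2 ↔ (encode q.num).bodd = true ∨ encode q.num < q.den := by
  rw [Rat.lt_iff, show (1 / 2 : ℚ).num = 1 by norm_num, show (1 / 2 : ℚ).den = 2 by norm_num]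
  have hq := q.pos
  obtain ⟨m, hm⟩ | ⟨m, hm⟩ : (∃ m : ℕ, q.num = m) ∨ ∃ m, q.num = Int.negSucc m := by
    cases q.num <;> simp
  · have h : encode q.num = 2 * m := by rw [hm]; rfl
    rw [h, hm]
    simp
    lia
  · have h : encode q.num = 2 * m + 1 := by rw [hm]; rfl
    rw [h, hm]
    simp
    lia

theorem Rat.computable_lt_half : Computable fun q : ℚ => decide (q < 1 / 2) := by
  have hF : PrimrecPred fun x : ℕ => x.unpair.1.bodd = true ∨ x.unpair.1 < x.unpair.2 :=
    PrimrecPred.or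
      (Primrec.eq.comp (Primrec.nat_bodd.comp (Primrec.fst.comp Primrec.unpair)) (.const true))
      (Primrec.nat_lt.comp (Primrec.fst.comp Primrec.unpair) (Primrec.snd.comp Primrec.unpair))
  have hrange : ComputablePred fun n => n ∈ Set.range instEncodable.encode :=
    primrecPred_mem_range_encode.imp fun _ h => h.to_comp
  have hcode := (computable_encode_ofNat_ofEncodableOfInfinite ℚ hrange).comp
    (Computable.encode (α := ℚ))
  refine (hF.decide.to_comp.comp hcode).of_eq fun q => ?_
  have hq : @ofNat ℚ (ofEncodableOfInfinite ℚ) (instDenumerable.encode q) = q := ofNat_encode q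
  have hcodes := (congrArg instEncodable.encode hq).trans (encode_eq_pair q)
  rw [decide_eq_decide, hcodes, Nat.unpair_pair, lt_half_iff]

/-- No-go lemma instance: there is no computable `v : ℕ → ℕ → ℚ` such that
for every code `e`, `v t e → 1` as `t → ∞` if the `e`-th partial computable
function is total, and `v t e → 0` otherwise. -/
theorem stmt_4 :
    ¬ ∃ v : ℕ → ℕ → ℚ, Computable₂ v ∧
      ∀ e : ℕ,
        ((∀ n : ℕ, (((Denumerable.ofNat Nat.Partrec.Code e).eval n)).Dom) →
          Filter.Tendsto (fun t => v t e) Filter.atTop (nhds 1)) ∧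
        (¬ (∀ n : ℕ, (((Denumerable.ofNat Nat.Partrec.Code e).eval n)).Dom) →
          Filter.Tendsto (fun t => v t e) Filter.atTop (nhds 0)) := by
  rintro ⟨v, hv, hlim⟩
  have hsearch : Partrec₂ fun (c : Nat.Partrec.Code) (n : ℕ) =>
      Nat.rfind fun k => Part.some (decide (v (n + k) (encode c) < 1 / 2)) := by
    refine Partrec.rfind (Computable.partrec ?_)
    exact Rat.computable_lt_half.comp (hv.comp
      (Primrec.nat_add.to_comp.comp (Computable.snd.comp Computable.fst) Computable.snd)
      (Computable.encode.comp (Computable.fst.comp Computable.fst)))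
  obtain ⟨c, hc⟩ := Nat.Partrec.Code.fixed_point₂ hsearch
  have hdom (n : ℕ) : (c.eval n).Dom ↔ ∃ k, v (n + k) (encode c) < 1 / 2 := by
    rw [hc]
    exact Nat.rfind_dom'.trans (by simp)
  obtain ⟨htotal, hpartial⟩ := hlim (encode c)
  rw [Denumerable.ofNat_encode] at htotal hpartial
  by_cases h : ∀ n, (c.eval n).Dom
  · obtain ⟨n, hn⟩ := Filter.eventually_atTop.1
      ((htotal h).eventually_const_lt (show (1 / 2 : ℚ) < 1 by norm_num))
    obtain ⟨k, hk⟩ := (hdom n).1 (h n)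
    exact lt_asymm hk (hn _ (Nat.le_add_right n k))
  · obtain ⟨m, hm⟩ := Filter.eventually_atTop.1
      ((hpartial h).eventually_lt_const (show (0 : ℚ) < 1 / 2 by norm_num))
    exact h fun n => (hdom n).2 ⟨m, hm _ (Nat.le_add_left m n)⟩
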